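/- Let n ≥ 3, let K ⊂ ℝ^n be an affine body of revolution with hyperplane of revolution H, and let Γ be an affine hyperplane of ℝ^n such that Γ ∩ K has nonempty interior relative to Γ. Then Γ ∩ K is an affine body of revolution (inside the (n-1)-dimensional affine space Γ). Furthermore, if Γ is not parallel to H, then Γ ∩ H is a hyperplane of revolution of the affine body of revolution Γ ∩ K inside Γ. -/

import Mathlib

open Metric
open scoped RealInnerProductSpace

/-- The point `p` and unit direction `u` determine an axis of revolution of `K`. -/
def IsAxisOfRevolution {E : Type*} [NormedAddCommGroup E] [InnerProductSpace ℝ E]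
    (K : Set E) (p u : E) : Prop :=
  ‖u‖ = 1 ∧ ∀ t : ℝ,
    K ∩ {x | ⟪x - p, u⟫ = t} = ∅ ∨
    (∃ x, K ∩ {x | ⟪x - p, u⟫ = t} = {x}) ∨
    (∃ r : ℝ, 0 < r ∧
      K ∩ {x | ⟪x - p, u⟫ = t} = {x | ⟪x - p, u⟫ = t ∧ dist x (p + t • u) ≤ r})

/-- A convex body of revolution: a compact convex set with nonempty interior admitting
an axis of revolution. -/
def IsBodyOfRevolution {E : Type*} [NormedAddCommGroup E] [InnerProductSpace ℝ E]
    (K : Set E) : Prop :=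
  IsCompact K ∧ Convex ℝ K ∧ (interior K).Nonempty ∧ ∃ p u : E, IsAxisOfRevolution K p u

/-- An affine body of revolution: the image of a convex body of revolution under a
bijective affine map. -/
def IsAffineBodyOfRevolution {E : Type*} [NormedAddCommGroup E] [InnerProductSpace ℝ E]
    (K : Set E) : Prop :=
  ∃ (g : E ≃ᵃ[ℝ] E) (K₀ : Set E), IsBodyOfRevolution K₀ ∧ K = g '' K₀

/-- `H` is a hyperplane of revolution of the affine body of revolution `K`. -/
def IsHyperplaneOfRevolution {E : Type*} [NormedAddCommGroup E] [InnerProductSpace ℝ E]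
    (K H : Set E) : Prop :=
  ∃ (g : E ≃ᵃ[ℝ] E) (K₀ : Set E) (p u : E),
    IsCompact K₀ ∧ Convex ℝ K₀ ∧ (interior K₀).Nonempty ∧
    IsAxisOfRevolution K₀ p u ∧ K = g '' K₀ ∧ H = g '' {x | ⟪x, u⟫ = (0 : ℝ)}

/-- The preimage of a set of revolution under an isometric affine map `y ↦ q + L y` has an axis
of revolution in the direction `e`, provided the functional `⟪L ·, u⟫` is a multiple of `⟪·, e⟫`. -/
theorem IsAxisOfRevolution.preimage_isometry {E F : Type*}
    [NormedAddCommGroup E] [InnerProductSpace ℝ E] [CompleteSpace E]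
    [NormedAddCommGroup F] [InnerProductSpace ℝ F] [CompleteSpace F]
    {K : Set E} {p u : E} (h : IsAxisOfRevolution K p u) (L : F →ₗᵢ[ℝ] E) (q : E)
    {e : F} (he : ‖e‖ = 1) {κ : ℝ} (hκ : ∀ y, ⟪L y, u⟫ = κ * ⟪y, e⟫) :
    ∃ p' : F, IsAxisOfRevolution {y | q + L y ∈ K} p' e := by
  obtain ⟨p', hp'⟩ : ∃ p' : F, ∀ y, ⟪q + L p' - p, L y⟫ = 0 := by
    refine ⟨ContinuousLinearMap.adjoint L.toContinuousLinearMap (p - q), fun y => ?_⟩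
    have h1 : ⟪L (ContinuousLinearMap.adjoint L.toContinuousLinearMap (p - q)), L y⟫
        = ⟪p - q, L y⟫ := by
      rw [L.inner_map_map, ContinuousLinearMap.adjoint_inner_left]
      rfl
    rw [add_sub_right_comm, inner_add_left, h1, ← inner_add_left]
    simp
  refine ⟨p', he, fun s => ?_⟩
  set t : ℝ := ⟪q + L p' - p, u⟫ + κ * s with ht
  set c : E := (q + L p' - p) + s • L e - t • u with hc
  have hee : ⟪e, e⟫ = 1 := by rw [real_inner_self_eq_norm_sq, he, one_pow]
  have height : ∀ y, ⟪y - p', e⟫ = s → ⟪q + L y - p, u⟫ = t := by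
    intro y hy
    have : q + L y - p = (q + L p' - p) + L (y - p') := by rw [map_sub]; abel
    rw [this, inner_add_left, hκ, hy]
  have pythagoras : ∀ y, ⟪y - p', e⟫ = s →
      dist (q + L y) (p + t • u) ^ 2 = ‖c‖ ^ 2 + dist y (p' + s • e) ^ 2 := by
    intro y hy
    set w : F := y - (p' + s • e) with hw
    have hwe : ⟪w, e⟫ = 0 := by
      rw [hw, ← sub_sub, inner_sub_left, hy, real_inner_smul_left, hee]; ring
    have hcw : ⟪c, L w⟫ = 0 := by
      rw [hc, inner_sub_left, inner_add_left, hp', real_inner_smul_left, real_inner_smul_left,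
        L.inner_map_map, real_inner_comm, hwe, real_inner_comm, hκ, hwe]
      ring
    have hsum : q + L y - (p + t • u) = c + L w := by
      rw [hc, hw]; simp only [map_sub, map_add, map_smul]; abel
    rw [dist_eq_norm, dist_eq_norm, hsum, norm_add_sq_real, hcw, L.norm_map]
    ring
  have mem_iff : ∀ y, ⟪y - p', e⟫ = s →
      (q + L y ∈ K ↔ q + L y ∈ K ∩ {x | ⟪x - p, u⟫ = t}) := fun y hy =>
    ⟨fun hK => ⟨hK, height y hy⟩, fun hK => hK.1⟩
  rcases h.2 t with h0 | ⟨x, h1⟩ | ⟨r, hr, h2⟩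
  · left
    ext y
    simp only [Set.mem_inter_iff, Set.mem_ofPred_eq, Set.mem_empty_iff_false, iff_false, not_and]
    intro hy hs
    rw [mem_iff y hs, h0] at hy
    exact hy
  · have hsub : ({y | q + L y ∈ K} ∩ {y | ⟪y - p', e⟫ = s}).Subsingleton := by
      rintro y ⟨hy, hys⟩ z ⟨hz, hzs⟩
      rw [Set.mem_ofPred_eq, mem_iff _ hys, h1, Set.mem_singleton_iff] at hy
      rw [Set.mem_ofPred_eq, mem_iff _ hzs, h1, Set.mem_singleton_iff] at hz
      exact L.injective (add_left_cancel (hy.trans hz.symm))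
    rcases hsub.eq_empty_or_singleton with h | h
    · exact Or.inl h
    · exact Or.inr (Or.inl h)
  · have key : {y | q + L y ∈ K} ∩ {y | ⟪y - p', e⟫ = s} =
        {y | ⟪y - p', e⟫ = s ∧ ‖c‖ ^ 2 + dist y (p' + s • e) ^ 2 ≤ r ^ 2} := by
      ext y
      rw [Set.mem_inter_iff, and_comm]
      refine and_congr_right fun hs => ?_
      rw [Set.mem_ofPred_eq, mem_iff y hs, h2, ← pythagoras y hs]
      simp only [Set.mem_ofPred_eq, height y hs, true_and]
      rw [pow_le_pow_iff_left₀ dist_nonneg hr.le two_ne_zero]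
    rw [key]
    rcases lt_trichotomy (‖c‖ ^ 2) (r ^ 2) with hlt | heq | hgt
    · right; right
      refine ⟨√(r ^ 2 - ‖c‖ ^ 2), Real.sqrt_pos.2 (sub_pos.2 hlt), ?_⟩
      ext y
      refine and_congr_right fun _ => ?_
      rw [Real.le_sqrt dist_nonneg (sub_pos.2 hlt).le, le_sub_iff_add_le']
    · right; left
      refine ⟨p' + s • e, ?_⟩
      ext y
      simp only [Set.mem_ofPred_eq, Set.mem_singleton_iff, heq]
      constructor
      · rintro ⟨-, hy⟩
        have : dist y (p' + s • e) ^ 2 = 0 := le_antisymm (by linarith) (sq_nonneg _)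
        exact dist_eq_zero.1 (pow_eq_zero_iff two_ne_zero |>.1 this)
      · rintro rfl
        simp [real_inner_smul_left, he]
    · left
      ext y
      simp only [Set.mem_ofPred_eq, Set.mem_empty_iff_false, iff_false, not_and, not_le]
      intro _
      nlinarith [sq_nonneg (dist y (p' + s • e))]

/-- An injective linear map between Euclidean spaces is a linear automorphism followed by a
linear isometry. -/
theorem LinearMap.exists_eq_isometry_comp_equiv {E F : Type*}
    [NormedAddCommGroup E] [InnerProductSpace ℝ E]
    [NormedAddCommGroup F] [InnerProductSpace ℝ F] [FiniteDimensional ℝ F]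
    (f : F →ₗ[ℝ] E) (hf : Function.Injective f) :
    ∃ (L : F →ₗᵢ[ℝ] E) (h : F ≃ₗ[ℝ] F), ∀ v, f v = L (h v) := by
  let A : F ≃ₗ[ℝ] LinearMap.range f := LinearEquiv.ofInjective f hf
  let φ : F ≃ₗᵢ[ℝ] LinearMap.range f :=
    (stdOrthonormalBasis ℝ F).equiv (stdOrthonormalBasis ℝ _) (finCongr A.finrank_eq)
  refine ⟨(LinearMap.range f).subtypeₗᵢ.comp φ.toLinearIsometry, A.trans φ.symm.toLinearEquiv,
    fun v => ?_⟩
  simp [A]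

/-- If a convex set of revolution is pulled back along an affine isometry and then moved by an
affine automorphism `G`, the image under `G` of `e^⊥` is a hyperplane of revolution. -/
theorem IsAxisOfRevolution.isHyperplaneOfRevolution_section {E F : Type*}
    [NormedAddCommGroup E] [InnerProductSpace ℝ E] [CompleteSpace E]
    [NormedAddCommGroup F] [InnerProductSpace ℝ F] [FiniteDimensional ℝ F]
    {K : Set E} {p u : E} (h : IsAxisOfRevolution K p u) (hc : IsCompact K) (hK : Convex ℝ K)
    (L : F →ₗᵢ[ℝ] E) (q : E) {e : F} (he : ‖e‖ = 1) {κ : ℝ}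
    (hκ : ∀ y, ⟪L y, u⟫ = κ * ⟪y, e⟫) (G : F ≃ᵃ[ℝ] F)
    (hint : (interior (G '' {y | q + L y ∈ K})).Nonempty) :
    IsHyperplaneOfRevolution (G '' {y | q + L y ∈ K}) (G '' {y | ⟪y, e⟫ = (0 : ℝ)}) := by
  have : CompleteSpace F := FiniteDimensional.complete ℝ F
  obtain ⟨p', hp'⟩ := h.preimage_isometry L q he hκ
  have hemb : Topology.IsClosedEmbedding fun y => q + L y :=
    (Homeomorph.addLeft q).isClosedEmbedding.comp L.isometry.isClosedEmbedding
  refine ⟨G, _, p', e, hemb.isCompact_preimage hc, ?_, ?_, hp', rfl, rfl⟩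
  · exact (hK.translate_preimage_right q).linear_preimage L.toLinearMap
  · obtain ⟨x, hx⟩ := hint
    have hG : Continuous G := G.continuous_of_finiteDimensional
    have := preimage_interior_subset_interior_preimage (t := G '' {y | q + L y ∈ K}) hG
    rw [Set.preimage_image_eq _ G.injective] at this
    exact ⟨G.symm x, this (by simpa using hx)⟩

theorem exists_unit_inner_eq {F : Type*} [NormedAddCommGroup F] [InnerProductSpace ℝ F]
    {w : F} (hw : w ≠ 0) : ∃ e : F, ‖e‖ = 1 ∧ ∀ y, ⟪y, w⟫ = ‖w‖ * ⟪y, e⟫ := by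
  have hw1 : ‖w‖ ≠ 0 := norm_ne_zero_iff.2 hw
  refine ⟨‖w‖⁻¹ • w, ?_, fun y => ?_⟩
  · rw [norm_smul, norm_inv, norm_norm, inv_mul_cancel₀ hw1]
  · rw [real_inner_smul_right, mul_inv_cancel_left₀ hw1]

theorem IsHyperplaneOfRevolution.isAffineBodyOfRevolution {E : Type*}
    [NormedAddCommGroup E] [InnerProductSpace ℝ E] {K H : Set E}
    (h : IsHyperplaneOfRevolution K H) : IsAffineBodyOfRevolution K := by
  obtain ⟨g, K₀, p, u, h1, h2, h3, h4, h5, -⟩ := h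
  exact ⟨g, K₀, ⟨h1, h2, h3, p, u, h4⟩, h5⟩

/-- let `K ⊆ ℝ^n`, `n ≥ 3`, be an affine body of revolution with hyperplane
of revolution `H`, and let `Γ = p + D` be an affine hyperplane (here described by a point
`p` and an `(n-1)`-dimensional direction subspace `D`, and identified with `D` via
`v ↦ p + v`) such that the section `Γ ∩ K` has nonempty interior relative to `Γ`.
Then `Γ ∩ K` is an affine body of revolution inside `Γ`; moreover, if `Γ` is not parallel
to `H`, then `Γ ∩ H` is a hyperplane of revolution of `Γ ∩ K` inside `Γ`. -/
theorem section_of_affine_body_of_revolution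
    (n : ℕ) (hn : 3 ≤ n)
    (K H : Set (EuclideanSpace ℝ (Fin n)))
    (hKcompact : IsCompact K) (hKconv : Convex ℝ K) (hKint : (interior K).Nonempty)
    (hKH : IsHyperplaneOfRevolution K H)
    (p : EuclideanSpace ℝ (Fin n))
    (D : Submodule ℝ (EuclideanSpace ℝ (Fin n)))
    (hD : Module.finrank ℝ D = n - 1)
    (hsec : (interior {v : D | p + (v : EuclideanSpace ℝ (Fin n)) ∈ K}).Nonempty) :
    IsAffineBodyOfRevolution {v : D | p + (v : EuclideanSpace ℝ (Fin n)) ∈ K} ∧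
    ((¬ ∃ w : EuclideanSpace ℝ (Fin n),
        (fun x => x + w) '' H = {x | x - p ∈ D}) →
      IsHyperplaneOfRevolution {v : D | p + (v : EuclideanSpace ℝ (Fin n)) ∈ K}
        {v : D | p + (v : EuclideanSpace ℝ (Fin n)) ∈ H}) := by
  obtain ⟨g, K₀, p₀, u, hK₀c, hK₀, -, hax, rfl, rfl⟩ := hKH
  obtain ⟨L, h, hLh⟩ := LinearMap.exists_eq_isometry_comp_equiv
    (g.symm.linear.toLinearMap ∘ₗ D.subtype)
    (g.symm.linear.injective.comp D.injective_subtype)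
  have hgsymm : ∀ v : D, g.symm (p + v) = g.symm p + L (h v) := by
    intro v
    rw [← hLh, add_comm p, ← vadd_eq_add, g.symm.map_vadd, vadd_eq_add, add_comm]
    rfl
  have mem_image : ∀ (S : Set (EuclideanSpace ℝ (Fin n))) (v : D),
      p + (v : EuclideanSpace ℝ (Fin n)) ∈ g '' S ↔ g.symm p + L (h v) ∈ S := by
    intro S v
    rw [← hgsymm]
    constructor
    · rintro ⟨x, hx, hxv⟩
      rwa [← hxv, g.symm_apply_apply]
    · exact fun hv => ⟨_, hv, g.apply_symm_apply _⟩
  let G (x₀ : D) : D ≃ᵃ[ℝ] D := (AffineEquiv.constVAdd ℝ D x₀).trans h.symm.toAffineEquiv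
  have image_G : ∀ (S : Set (EuclideanSpace ℝ (Fin n))) (x₀ : D),
      {v : D | p + (v : EuclideanSpace ℝ (Fin n)) ∈ g '' S} =
        G x₀ '' {y | (g.symm p + L x₀) + L y ∈ S} := by
    intro S x₀
    ext v
    rw [Set.mem_ofPred_eq, mem_image]
    constructor
    · intro hv
      refine ⟨h v - x₀, ?_, ?_⟩
      · rw [Set.mem_ofPred_eq, add_assoc, ← map_add, add_sub_cancel]
        exact hv
      · simp [G]
    · rintro ⟨y, hy, rfl⟩
      simpa [G, add_assoc] using hy
  have section_revolution : ∀ (e : D) (κ : ℝ) (x₀ : D), ‖e‖ = 1 →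
      (∀ y, ⟪L y, u⟫ = κ * ⟪y, e⟫) →
      IsHyperplaneOfRevolution {v : D | p + (v : EuclideanSpace ℝ (Fin n)) ∈ g '' K₀}
        (G x₀ '' {y | ⟪y, e⟫ = (0 : ℝ)}) := by
    intro e κ x₀ he hκ
    rw [image_G K₀ x₀] at hsec ⊢
    exact hax.isHyperplaneOfRevolution_section hK₀c hK₀ L _ he hκ _ hsec
  obtain ⟨w, hw⟩ : ∃ w : D, ∀ y, ⟪L y, u⟫ = ⟪y, w⟫ :=
    ⟨ContinuousLinearMap.adjoint L.toContinuousLinearMap u, fun y => by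
      rw [ContinuousLinearMap.adjoint_inner_right]; rfl⟩
  by_cases hw0 : w = 0
  · subst hw0
    have : Nontrivial D := Module.nontrivial_of_finrank_pos (R := ℝ) (by omega)
    obtain ⟨e, he⟩ := exists_norm_eq D zero_le_one
    refine ⟨(section_revolution e 0 0 he fun y => by simp [hw]).isAffineBodyOfRevolution,
      fun hpar => (hpar ?_).elim⟩
    have hu0 : u ≠ 0 := fun h0 => by simpa [h0] using hax.1
    have hD' : D.map g.symm.linear.toLinearMap = (ℝ ∙ u)ᗮ := by
      apply Submodule.eq_of_le_of_finrank_eq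
      · rintro _ ⟨v, hv, rfl⟩
        rw [Submodule.mem_orthogonal_singleton_iff_inner_left]
        have := hLh ⟨v, hv⟩
        simp only [LinearMap.comp_apply, Submodule.subtype_apply] at this
        rw [this, hw, inner_zero_right]
      · have h1 := Submodule.finrank_add_finrank_orthogonal (ℝ ∙ u)
        rw [finrank_span_singleton hu0, finrank_euclideanSpace_fin] at h1
        have h2 : Module.finrank ℝ (D.map g.symm.linear.toLinearMap) = Module.finrank ℝ D :=
          LinearEquiv.finrank_map_eq g.symm.linear D
        omega
    have mem_D : ∀ z, z ∈ D ↔ ⟪g.symm.linear z, u⟫ = 0 := by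
      intro z
      rw [← Submodule.mem_orthogonal_singleton_iff_inner_left, ← hD']
      exact (Function.Injective.mem_set_image g.symm.linear.injective).symm
    refine ⟨p - g 0, ?_⟩
    ext x
    have hx : g.symm.linear (x - p) = g.symm (x - (p - g 0)) := by
      have : x - (p - g 0) = (x - p) +ᵥ g 0 := by rw [vadd_eq_add]; abel
      rw [this, g.symm.map_vadd, g.symm_apply_apply, vadd_eq_add, add_zero]
    rw [Set.mem_ofPred_eq, mem_D, hx]
    constructor
    · rintro ⟨_, ⟨y, hy, rfl⟩, rfl⟩
      simpa using hy
    · intro hy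
      exact ⟨x - (p - g 0), ⟨_, hy, g.apply_symm_apply _⟩, sub_add_cancel _ _⟩
  · have hw1 : ‖w‖ ≠ 0 := norm_ne_zero_iff.2 hw0
    obtain ⟨e, he, hwe⟩ := exists_unit_inner_eq hw0
    have hκ : ∀ y, ⟪L y, u⟫ = ‖w‖ * ⟪y, e⟫ := fun y => (hw y).trans (hwe y)
    refine ⟨(section_revolution e _ 0 he hκ).isAffineBodyOfRevolution, fun _ => ?_⟩
    obtain ⟨x₀, hx₀⟩ : ∃ x₀ : D, ⟪g.symm p + L x₀, u⟫ = 0 := by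
      refine ⟨(-⟪g.symm p, u⟫ / ⟪L w, u⟫) • w, ?_⟩
      have hne : ⟪L w, u⟫ ≠ 0 := by rw [hw]; exact inner_self_ne_zero.2 hw0
      rw [inner_add_left, map_smul, real_inner_smul_left, div_mul_cancel₀ _ hne, add_neg_cancel]
    convert section_revolution e _ x₀ he hκ using 1
    rw [image_G _ x₀]
    congr 1
    ext y
    rw [Set.mem_ofPred_eq, Set.mem_ofPred_eq, Set.mem_ofPred_eq, inner_add_left, hx₀, zero_add, hκ,
      mul_eq_zero, or_iff_right hw1]
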